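/- There is no 3-in-out graph on 5 vertices; that is, no digraph on a 5-element vertex set admits designations of 3 distinct incoming vertices and 3 distinct outgoing vertices satisfying the paired vertices condition and the single visit condition. -/

import Mathlib

/-- A directed path in the digraph with edge relation `E` and vertex set `Vset`:
a nonempty list of distinct vertices of `Vset`, with consecutive vertices joined
by directed edges. -/
def IsPathOn {α : Type*} (E : α → α → Prop) (Vset : Finset α) (p : List α) : Prop :=
  p ≠ [] ∧ p.Nodup ∧ p.Chain' E ∧ ∀ x ∈ p, x ∈ Vset

/-- A Hamiltonian path from `u` to `v` in the digraph with edge relation `E`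
and vertex set `Vset`: a list of distinct vertices containing every vertex of `Vset`
(and no others), starting at `u`, ending at `v`, with consecutive vertices joined
by directed edges. -/
def IsHamPathOn {α : Type*} (E : α → α → Prop) (Vset : Finset α) (u v : α)
    (p : List α) : Prop :=
  p.Nodup ∧ p.Chain' E ∧ p.head? = some u ∧ p.getLast? = some v ∧ ∀ x, x ∈ p ↔ x ∈ Vset

/-- The single visit condition: there is no collection of two or more pairwise
vertex-disjoint directed paths, each starting at an incoming vertex and ending at an
outgoing vertex, whose union visits every vertex. -/
def SingleVisit {α : Type*} (E : α → α → Prop) (Vset : Finset α) {k : ℕ}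
    (inc out : Fin k → α) : Prop :=
  ¬ ∃ P : Finset (List α), 2 ≤ P.card ∧
      (∀ p ∈ P, IsPathOn E Vset p ∧ (∃ j, p.head? = some (inc j)) ∧
        (∃ m, p.getLast? = some (out m))) ∧
      (∀ p ∈ P, ∀ q ∈ P, p ≠ q → ∀ x, x ∈ p → x ∉ q) ∧
      (∀ x ∈ Vset, ∃ p ∈ P, x ∈ p)

/-- A `k`-in-out graph: a digraph (no loops, all edges within the vertex set) together
with `k` distinct incoming vertices and `k` distinct outgoing vertices (the two sets may
overlap), satisfying the paired vertices condition and the single visit condition. -/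
structure IsInOutGraph {α : Type*} (E : α → α → Prop) (Vset : Finset α) {k : ℕ}
    (inc out : Fin k → α) : Prop where
  no_loops : ∀ x, ¬ E x x
  edge_mem : ∀ x y, E x y → x ∈ Vset ∧ y ∈ Vset
  inc_mem : ∀ j, inc j ∈ Vset
  out_mem : ∀ j, out j ∈ Vset
  inc_inj : Function.Injective inc
  out_inj : Function.Injective out
  paired : ∀ j m, (∃ p, IsHamPathOn E Vset (inc j) (out m) p) ↔ j = m
  single_visit : SingleVisit E Vset inc out

/-- Edge test: `(x, y)` is a consecutive pair of the list. -/
def adjIn : List ℕ → ℕ → ℕ → Bool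
  | a :: b :: t, x, y => (Nat.beq x a && Nat.beq y b) || adjIn (b :: t) x y
  | _, _, _ => false

/-- Membership in `{0, 1, 2}` (the incoming vertices). -/
def isInc (y : ℕ) : Bool := Nat.blt y 3

/-- Membership in the set of outgoing vertices. -/
def isOut (o0 o1 o2 x : ℕ) : Bool := Nat.beq x o0 || (Nat.beq x o1 || Nat.beq x o2)

/-- Incoming vertex `s` is paired with outgoing vertex `t`. -/
def pairedB (o0 o1 o2 s t : ℕ) : Bool :=
  (Nat.beq s 0 && Nat.beq t o0) || ((Nat.beq s 1 && Nat.beq t o1) || (Nat.beq s 2 && Nat.beq t o2))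

def five : List ℕ := [0, 1, 2, 3, 4]

/-- A consecutive pair may be cut. -/
def cutB (o0 o1 o2 x y : ℕ) : Bool := isOut o0 o1 o2 x && isInc y

/-- There is an enumeration of the vertices which is a violation. -/
def viol (o0 o1 o2 : ℕ) (U : ℕ → ℕ → Bool) : Bool :=
  five.any fun a => isInc a && five.any fun b =>
    (!Nat.beq b a) && ((cutB o0 o1 o2 a b || U a b) && five.any fun c =>
    (!Nat.beq c a) && ((!Nat.beq c b) && ((cutB o0 o1 o2 b c || U b c) && five.any fun d =>
    (!Nat.beq d a) && ((!Nat.beq d b) && ((!Nat.beq d c) && ((cutB o0 o1 o2 c d || U c d) &&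
    five.any fun e =>
    (!Nat.beq e a) && ((!Nat.beq e b) && ((!Nat.beq e c) && ((!Nat.beq e d) &&
    (isOut o0 o1 o2 e && ((cutB o0 o1 o2 d e || U d e) &&
    ((!pairedB o0 o1 o2 a e) || (cutB o0 o1 o2 a b || (cutB o0 o1 o2 b c ||
      (cutB o0 o1 o2 c d || cutB o0 o1 o2 d e)))))))))))))))

/-- Quantify over all orderings from `s` to `t`. -/
def allPaths (s t : ℕ) (f : List ℕ → Bool) : Bool :=
  Nat.beq s t || five.all fun a => Nat.beq a s || (Nat.beq a t || five.all fun b =>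
    Nat.beq b s || (Nat.beq b t || (Nat.beq b a || five.all fun c =>
    Nat.beq c s || (Nat.beq c t || (Nat.beq c a || (Nat.beq c b || f [s, a, b, c, t]))))))

def checkAll : Bool :=
  five.all fun o0 => five.all fun o1 => Nat.beq o0 o1 || five.all fun o2 =>
    Nat.beq o0 o2 || (Nat.beq o1 o2 ||
    allPaths 0 o0 fun p => viol o0 o1 o2 (adjIn p) ||
    allPaths 1 o1 fun q => viol o0 o1 o2 (adjIn q) ||
      viol o0 o1 o2 (fun x y => adjIn p x y || adjIn q x y) ||
    allPaths 2 o2 fun r => viol o0 o1 o2 (fun x y => adjIn p x y || (adjIn q x y || adjIn r x y)))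

theorem checkAll_true : checkAll = true := by decide +kernel

theorem split_parts {α : Type*} (E : α → α → Prop) (I O : α → Prop) :
    ∀ (t : List α) (x : α),
      (x :: t).IsChain (fun x y => (O x ∧ I y) ∨ E x y) →
      (∀ z, (x :: t).getLast? = some z → O z) →
      ∃ (p : List α) (ps : List (List α)), p.head? = some x ∧ p ++ ps.flatten = x :: t ∧
        p.IsChain E ∧ (∃ z, p.getLast? = some z ∧ O z) ∧
        (∀ q ∈ ps, q.IsChain E ∧ (∃ z, q.head? = some z ∧ I z) ∧
          (∃ z, q.getLast? = some z ∧ O z)) ∧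
        (ps = [] → (x :: t).IsChain (fun x y => ¬ (O x ∧ I y))) := by
  intro t
  induction t with
  | nil =>
    intro x _ hl
    exact ⟨[x], [], by simp, by simp, by simp, ⟨x, by simp, hl x (by simp)⟩, by simp, by simp⟩
  | cons y t ih =>
    intro x hc hl
    rw [List.isChain_cons_cons] at hc
    obtain ⟨p, ps, h1, h2, h3, h4, h5, h6⟩ := ih y hc.2 (fun z hz => hl z (by
      rw [List.getLast?_cons_cons]; exact hz))
    by_cases hcut : O x ∧ I y
    · refine ⟨[x], p :: ps, by simp, by simp [h2], by simp, ⟨x, by simp, hcut.1⟩, ?_, by simp⟩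
      intro q hq
      rcases List.mem_cons.1 hq with rfl | hq
      · exact ⟨h3, ⟨y, h1, hcut.2⟩, h4⟩
      · exact h5 q hq
    · have hE : E x y := hc.1.resolve_left hcut
      cases p with
      | nil => simp at h1
      | cons y' p =>
        obtain rfl : y' = y := by simpa using h1
        refine ⟨x :: y' :: p, ps, by simp, by simpa using h2, ?_, ?_, h5, ?_⟩
        · exact List.isChain_cons_cons.2 ⟨hE, h3⟩
        · simpa [List.getLast?_cons_cons] using h4
        · intro h
          exact List.isChain_cons_cons.2 ⟨hcut, h6 h⟩

theorem no_cut {α : Type*} [DecidableEq α] {E : α → α → Prop} {Vset : Finset α} {k : ℕ}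
    {inc out : Fin k → α} (hs : SingleVisit E Vset inc out) (x : α) (t : List α)
    (hnd : (x :: t).Nodup) (hmem : ∀ z, z ∈ x :: t ↔ z ∈ Vset)
    (hc : (x :: t).IsChain (fun x y => ((∃ m, x = out m) ∧ (∃ j, y = inc j)) ∨ E x y))
    (hx : ∃ j, x = inc j) (hl : ∀ z, (x :: t).getLast? = some z → ∃ m, z = out m) :
    (x :: t).IsChain (fun x y => ¬ ((∃ m, x = out m) ∧ (∃ j, y = inc j))) ∧
      (x :: t).IsChain E := by
  obtain ⟨p, ps, h1, h2, h3, h4, h5, h6⟩ :=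
    split_parts E (fun y => ∃ j, y = inc j) (fun y => ∃ m, y = out m) t x hc hl
  have hps : ps = [] := by
    by_contra hne
    apply hs
    have hflat : (p :: ps).flatten = x :: t := by simpa using h2
    have hall : ∀ q ∈ p :: ps, q.IsChain E ∧ (∃ z, q.head? = some z ∧ ∃ j, z = inc j) ∧
          (∃ z, q.getLast? = some z ∧ ∃ m, z = out m) := by
      intro q hq
      rcases List.mem_cons.1 hq with rfl | hq
      · exact ⟨h3, ⟨x, h1, hx⟩, h4⟩
      · exact h5 q hq
    rw [← hflat, List.nodup_flatten] at hnd
    have hne' : ∀ q ∈ p :: ps, q ≠ [] := by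
      intro q hq h
      obtain ⟨_, ⟨z, hz, _⟩, _⟩ := hall q hq
      simp [h] at hz
    have hnd2 : (p :: ps).Nodup := by
      refine List.Pairwise.imp_of_mem ?_ hnd.2
      intro a b ha hb hd hab
      subst hab
      obtain ⟨z, hz⟩ := List.exists_mem_of_ne_nil a (hne' a ha)
      exact hd hz hz
    have hmemf : ∀ z, (∃ q ∈ p :: ps, z ∈ q) ↔ z ∈ Vset := by
      intro z
      rw [← hmem, ← hflat, List.mem_flatten]
    refine ⟨(p :: ps).toFinset, ?_, ?_, ?_, ?_⟩
    · rw [List.toFinset_card_of_nodup hnd2]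
      have := List.length_pos_of_ne_nil hne
      simp; omega
    · intro q hq
      rw [List.mem_toFinset] at hq
      obtain ⟨c, ⟨z, hz, j, rfl⟩, ⟨w, hw, m, rfl⟩⟩ := hall q hq
      exact ⟨⟨hne' q hq, hnd.1 q hq, c, fun y hy => (hmemf y).1 ⟨q, hq, hy⟩⟩, ⟨j, hz⟩, ⟨m, hw⟩⟩
    · intro a ha b hb hab y hya hyb
      rw [List.mem_toFinset] at ha hb
      have hp : (p :: ps).Pairwise (fun a b => List.Disjoint a b) := hnd.2
      have hsymm : ∀ a b : List α, List.Disjoint a b → List.Disjoint b a := fun _ _ h => h.symm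
      haveI : Std.Symm (fun a b : List α => List.Disjoint a b) := ⟨hsymm⟩
      exact hp.forall ha hb hab hya hyb
    · intro z hz
      obtain ⟨q, hq, hzq⟩ := (hmemf z).2 hz
      exact ⟨q, List.mem_toFinset.2 hq, hzq⟩
  subst hps
  refine ⟨h6 rfl, ?_⟩
  rw [← h2]; simpa using h3

theorem adjIn_sound {α : Type*} {E : α → α → Prop} (v : ℕ → α) :
    ∀ (l : List ℕ), (l.map v).IsChain E → ∀ x y, adjIn l x y = true → E (v x) (v y)
  | [], _, x, y, h => by simp [adjIn] at h
  | [a], _, x, y, h => by simp [adjIn] at h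
  | a :: b :: t, hc, x, y, h => by
    simp only [List.map_cons, List.isChain_cons_cons] at hc
    simp only [adjIn, Bool.or_eq_true, Bool.and_eq_true, Nat.beq_eq] at h
    rcases h with ⟨rfl, rfl⟩ | h
    · exact hc.1
    · exact adjIn_sound v (b :: t) (by simpa using hc.2) x y h

theorem mem_five (x : ℕ) : x ∈ five ↔ x < 5 := by
  simp [five]; omega

theorem allPaths_spec {s t : ℕ} {f : List ℕ → Bool} (h : allPaths s t f = true)
    {a b c : ℕ} (ha : a < 5) (hb : b < 5) (hc : c < 5) (hn : [s, a, b, c, t].Nodup) :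
    f [s, a, b, c, t] = true := by
  simp only [allPaths, Bool.or_eq_true, Nat.beq_eq, List.all_eq_true, mem_five] at h
  simp at hn
  have h1 := (h.resolve_left (by tauto)) a ha
  have h2 := ((h1.resolve_left (by tauto)).resolve_left (by tauto)) b hb
  have h3 := (((h2.resolve_left (by tauto)).resolve_left (by tauto)).resolve_left (by tauto)) c hc
  exact (((h3.resolve_left (by tauto)).resolve_left (by tauto)).resolve_left
    (by tauto)).resolve_left (by tauto)

theorem perm_mem {α : Type*} {Vset : Finset α} {v : ℕ → α} 
    (hv : ∀ z, z ∈ Vset ↔ ∃ n < 5, v n = z)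
    {a b c d e : ℕ} (hlt : ∀ n ∈ [a, b, c, d, e], n < 5) (hn : [a, b, c, d, e].Nodup) :
    ∀ z, z ∈ [a, b, c, d, e].map v ↔ z ∈ Vset := by
  have hfs : [a, b, c, d, e].toFinset = Finset.range 5 := by
    apply Finset.eq_of_subset_of_card_le
    · intro n hn'
      rw [List.mem_toFinset] at hn'
      exact Finset.mem_range.2 (hlt n hn')
    · rw [List.toFinset_card_of_nodup hn]; simp
  intro z
  rw [hv, List.mem_map]
  constructor
  · rintro ⟨n, h, rfl⟩
    exact ⟨n, hlt n h, rfl⟩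
  · rintro ⟨n, h, rfl⟩
    refine ⟨n, ?_, rfl⟩
    rw [← List.mem_toFinset, hfs]
    exact Finset.mem_range.2 h

theorem viol_sound {α : Type*} [DecidableEq α] {E : α → α → Prop} {Vset : Finset α}
    {inc out : Fin 3 → α} (G : IsInOutGraph E Vset inc out) {v : ℕ → α}
    (hv : ∀ z, z ∈ Vset ↔ ∃ n < 5, v n = z)
    (hinj : ∀ m < 5, ∀ n < 5, v m = v n → m = n)
    (hi0 : inc 0 = v 0) (hi1 : inc 1 = v 1) (hi2 : inc 2 = v 2)
    {o0 o1 o2 : ℕ} (ho0 : out 0 = v o0) (ho1 : out 1 = v o1) (ho2 : out 2 = v o2)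
    {U : ℕ → ℕ → Bool} (hU : ∀ x y, U x y = true → E (v x) (v y)) :
    viol o0 o1 o2 U = false := by
  have hI : ∀ x, isInc x = true → ∃ j, v x = inc j := by
    intro x hx
    have : x < 3 := by simpa [isInc] using hx
    interval_cases x
    exacts [⟨0, hi0.symm⟩, ⟨1, hi1.symm⟩, ⟨2, hi2.symm⟩]
  have hO : ∀ x, isOut o0 o1 o2 x = true → ∃ j, v x = out j := by
    intro x hx
    simp only [isOut, Bool.or_eq_true, Nat.beq_eq] at hx
    rcases hx with rfl | rfl | rfl
    exacts [⟨0, ho0.symm⟩, ⟨1, ho1.symm⟩, ⟨2, ho2.symm⟩]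
  have hP : ∀ s < 5, ∀ t, isInc s = true → isOut o0 o1 o2 t = true →
      (∃ p, IsHamPathOn E Vset (v s) (v t) p) → pairedB o0 o1 o2 s t = true := by
    intro s _ t hs ht hp
    have : s < 3 := by simpa [isInc] using hs
    simp only [isOut, Bool.or_eq_true, Nat.beq_eq] at ht
    have key : ∀ j m, inc j = v s → out m = v t → j = m := by
      intro j m h1 h2
      rw [← h1, ← h2] at hp
      exact (G.paired j m).1 hp
    simp only [pairedB, Bool.or_eq_true, Bool.and_eq_true, Nat.beq_eq]
    interval_cases s
    · rcases ht with rfl | rfl | rfl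
      · simp
      · exact absurd (key 0 1 hi0 ho1) (by decide)
      · exact absurd (key 0 2 hi0 ho2) (by decide)
    · rcases ht with rfl | rfl | rfl
      · exact absurd (key 1 0 hi1 ho0) (by decide)
      · simp
      · exact absurd (key 1 2 hi1 ho2) (by decide)
    · rcases ht with rfl | rfl | rfl
      · exact absurd (key 2 0 hi2 ho0) (by decide)
      · exact absurd (key 2 1 hi2 ho1) (by decide)
      · simp
  have hR : ∀ x y, (cutB o0 o1 o2 x y = true ∨ U x y = true) →
      ((∃ m, v x = out m) ∧ (∃ j, v y = inc j)) ∨ E (v x) (v y) := by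
    intro x y h
    rcases h with h | h
    · simp only [cutB, Bool.and_eq_true] at h
      exact Or.inl ⟨hO x h.1, hI y h.2⟩
    · exact Or.inr (hU x y h)
  have hC : ∀ x y, cutB o0 o1 o2 x y = true →
      ((∃ m, v x = out m) ∧ (∃ j, v y = inc j)) := by
    intro x y h
    simp only [cutB, Bool.and_eq_true] at h
    exact ⟨hO x h.1, hI y h.2⟩
  rw [Bool.eq_false_iff]
  intro h
  simp only [viol, List.any_eq_true, mem_five, Bool.and_eq_true, Bool.not_eq_true',
    Bool.or_eq_true] at h
  obtain ⟨a, ha, hia, b, hb, hba, hab, c, hc, hca, hcb, hbc, d, hd, hda, hdb, hdc, hcd, e, he,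
    hea, heb, hec, hed, hoe, hde, hfin⟩ := h
  have nb : ∀ {x y : ℕ}, Nat.beq x y = false → x ≠ y := by
    intro x y h1 h2
    subst h2
    simp at h1
  have hlt : ∀ n ∈ [a, b, c, d, e], n < 5 := by simp; tauto
  have hn : [a, b, c, d, e].Nodup := by
    have := nb hba; have := nb hca; have := nb hcb; have := nb hda; have := nb hdb
    have := nb hdc; have := nb hea; have := nb heb; have := nb hec; have := nb hed
    simp; omega
  have hmem := perm_mem hv hlt hn
  have hnd : ([a, b, c, d, e].map v).Nodup :=
    hn.map_on (fun x hx y hy hxy => hinj x (hlt x hx) y (hlt y hy) hxy)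
  have hboth := no_cut G.single_visit (v a) [v b, v c, v d, v e] hnd hmem
    (by simp only [List.isChain_cons_cons, List.isChain_singleton, and_true]
        exact ⟨hR _ _ hab, hR _ _ hbc, hR _ _ hcd, hR _ _ hde⟩)
    (hI a hia) (by intro z hz; simp at hz; subst hz; exact hO e hoe)
  obtain ⟨hnc, hch⟩ := hboth
  have hpair := hP a ha e hia hoe ⟨_, hnd, hch, by simp, by simp, hmem⟩
  simp only [List.isChain_cons_cons, List.isChain_singleton, and_true] at hnc
  rcases hfin with h | h | h | h | h
  · rw [hpair] at h; exact absurd h (by decide)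
  · exact hnc.1 (hC _ _ h)
  · exact hnc.2.1 (hC _ _ h)
  · exact hnc.2.2.1 (hC _ _ h)
  · exact hnc.2.2.2 (hC _ _ h)

theorem ham_shape {α : Type*} [DecidableEq α] {E : α → α → Prop} {Vset : Finset α}
    (hcard : Vset.card = 5) {v : ℕ → α} (hv : ∀ z, z ∈ Vset ↔ ∃ n < 5, v n = z)
    (hinj : ∀ m < 5, ∀ n < 5, v m = v n → m = n) {s t : ℕ} (hs : s < 5) (ht : t < 5)
    (h : ∃ p, IsHamPathOn E Vset (v s) (v t) p) :
    ∃ a < 5, ∃ b < 5, ∃ c < 5, [s, a, b, c, t].Nodup ∧ ([s, a, b, c, t].map v).IsChain E := by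
  obtain ⟨p, hnd, hch, hh, hl, hm⟩ := h
  have hlen : p.length = 5 := by
    rw [← List.toFinset_card_of_nodup hnd, ← hcard]
    congr 1
    ext z; rw [List.mem_toFinset, hm]
  match p, hlen with
  | [x0, x1, x2, x3, x4], _ =>
    simp at hh hl
    subst hh hl
    obtain ⟨a, ha, rfl⟩ := (hv x1).1 ((hm x1).1 (by simp))
    obtain ⟨b, hb, rfl⟩ := (hv x2).1 ((hm x2).1 (by simp))
    obtain ⟨c, hc, rfl⟩ := (hv x3).1 ((hm x3).1 (by simp))
    refine ⟨a, ha, b, hb, c, hc, ?_, hch⟩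
    exact List.Nodup.of_map v hnd

/-- there is no 3-in-out graph on 5 vertices. -/
theorem no_threeInOut_on_five_vertices {α : Type*} [DecidableEq α]
    (E : α → α → Prop) (Vset : Finset α) (inc out : Fin 3 → α)
    (hcard : Vset.card = 5) :
    ¬ IsInOutGraph E Vset inc out := by
  intro G
  have h01 : inc 0 ≠ inc 1 := fun h => absurd (G.inc_inj h) (by decide)
  have h02 : inc 0 ≠ inc 2 := fun h => absurd (G.inc_inj h) (by decide)
  have h12 : inc 1 ≠ inc 2 := fun h => absurd (G.inc_inj h) (by decide)
  have hsub : ({inc 0, inc 1, inc 2} : Finset α) ⊆ Vset := by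
    intro z hz
    simp at hz
    rcases hz with rfl | rfl | rfl <;> exact G.inc_mem _
  have hc3 : ({inc 0, inc 1, inc 2} : Finset α).card = 3 := Finset.card_eq_three.2
    ⟨_, _, _, h01, h02, h12, rfl⟩
  have hc2 : (Vset \ {inc 0, inc 1, inc 2}).card = 2 := by
    rw [Finset.card_sdiff_of_subset hsub, hc3, hcard]
  obtain ⟨a, b, hab, hset⟩ := Finset.card_eq_two.1 hc2
  have hmem : ∀ z, (z ∈ Vset ∧ ¬ (z = inc 0 ∨ z = inc 1 ∨ z = inc 2)) ↔ (z = a ∨ z = b) := by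
    intro z
    have := congrArg (fun s => z ∈ s) hset
    simpa using this
  have hA := (hmem a).2 (Or.inl rfl)
  have hB := (hmem b).2 (Or.inr rfl)
  obtain ⟨v, hv0, hv1, hv2, hv3, hv4⟩ : ∃ v : ℕ → α, inc 0 = v 0 ∧ inc 1 = v 1 ∧ inc 2 = v 2 ∧
      a = v 3 ∧ b = v 4 :=
    ⟨fun n => match n with
      | 0 => inc 0
      | 1 => inc 1
      | 2 => inc 2
      | 3 => a
      | _ => b, rfl, rfl, rfl, rfl, rfl⟩
  have hv : ∀ z, z ∈ Vset ↔ ∃ n < 5, v n = z := by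
    intro z
    constructor
    · intro hz
      by_cases h : z = inc 0 ∨ z = inc 1 ∨ z = inc 2
      · rcases h with rfl | rfl | rfl
        exacts [⟨0, by decide, hv0.symm⟩, ⟨1, by decide, hv1.symm⟩, ⟨2, by decide, hv2.symm⟩]
      · rcases (hmem z).1 ⟨hz, h⟩ with rfl | rfl
        exacts [⟨3, by decide, hv3.symm⟩, ⟨4, by decide, hv4.symm⟩]
    · rintro ⟨n, hn, rfl⟩
      interval_cases n
      · rw [← hv0]; exact G.inc_mem _
      · rw [← hv1]; exact G.inc_mem _
      · rw [← hv2]; exact G.inc_mem _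
      · rw [← hv3]; exact hA.1
      · rw [← hv4]; exact hB.1
  have hinj : ∀ m < 5, ∀ n < 5, v m = v n → m = n := by
    have : Set.InjOn v (Finset.range 5 : Finset ℕ) := by
      apply Finset.injOn_of_card_image_eq
      rw [Finset.card_range, ← hcard]
      congr 1
      ext z
      rw [hv, Finset.mem_image]
      simp [hcard]
    intro m hm n hn h
    exact this (by simpa using hm) (by simpa using hn) h
  obtain ⟨o0, hl0, ho0⟩ := (hv _).1 (G.out_mem 0)
  obtain ⟨o1, hl1, ho1⟩ := (hv _).1 (G.out_mem 1)
  obtain ⟨o2, hl2, ho2⟩ := (hv _).1 (G.out_mem 2)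
  have hout : ∀ i j, i ≠ j → ∀ m n, v m = out i → v n = out j → m ≠ n := by
    rintro i j hij m n h1 h2 rfl
    exact hij (G.out_inj (h1.symm.trans h2))
  have g0 := (G.paired 0 0).2 rfl
  have g1 := (G.paired 1 1).2 rfl
  have g2 := (G.paired 2 2).2 rfl
  rw [hv0, ← ho0] at g0
  rw [hv1, ← ho1] at g1
  rw [hv2, ← ho2] at g2
  obtain ⟨a0, la0, b0, lb0, c0, lc0, n0, p0⟩ := ham_shape hcard hv hinj (by decide) hl0 g0
  obtain ⟨a1, la1, b1, lb1, c1, lc1, n1, p1⟩ := ham_shape hcard hv hinj (by decide) hl1 g1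
  obtain ⟨a2, la2, b2, lb2, c2, lc2, n2, p2⟩ := ham_shape hcard hv hinj (by decide) hl2 g2
  have s0 := adjIn_sound v _ p0
  have s1 := adjIn_sound v _ p1
  have s2 := adjIn_sound v _ p2
  have hviol : ∀ U : ℕ → ℕ → Bool, (∀ x y, U x y = true → E (v x) (v y)) →
      ¬ viol o0 o1 o2 U = true := by
    intro U hU
    rw [viol_sound G hv hinj hv0 hv1 hv2 ho0.symm ho1.symm ho2.symm hU]
    decide
  have hck := checkAll_true
  simp only [checkAll, List.all_eq_true, mem_five, Bool.or_eq_true, Nat.beq_eq] at hck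
  have k1 := ((hck o0 hl0 o1 hl1).resolve_left (hout 0 1 (by decide) _ _ ho0 ho1)) o2 hl2
  have k2 := (k1.resolve_left (hout 0 2 (by decide) _ _ ho0 ho2)).resolve_left
    (hout 1 2 (by decide) _ _ ho1 ho2)
  have k3 := allPaths_spec k2 la0 lb0 lc0 n0
  simp only [Bool.or_eq_true] at k3
  have k4 := allPaths_spec (k3.resolve_left (hviol _ s0)) la1 lb1 lc1 n1
  simp only [Bool.or_eq_true] at k4
  have k5 := k4.resolve_left (by
    rintro (h | h)
    · exact hviol _ s1 h
    · refine hviol _ ?_ h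
      intro x y hxy
      rw [Bool.or_eq_true] at hxy
      exact hxy.elim (s0 x y) (s1 x y))
  have k6 := allPaths_spec k5 la2 lb2 lc2 n2
  refine hviol _ ?_ k6
  intro x y hxy
  simp only [Bool.or_eq_true] at hxy
  exact hxy.elim (s0 x y) (fun h => h.elim (s1 x y) (s2 x y))
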